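/- The longest ternary word containing at most one distinct abelian square factor has length 18: the word abcbabccacccbabcba contains exactly one distinct abelian square factor, and every word of length 19 over a three-letter alphabet contains at least two distinct abelian square factors. -/

import Mathlib

/-- Two words are Parikh-equivalent (abelian-equivalent) if every letter occurs
the same number of times in each. -/
def ParikhEq {α : Type*} [DecidableEq α] (u v : List α) : Prop :=
  ∀ a : α, u.count a = v.count a

/-- A word is an abelian square if it is the concatenation of two nonempty
Parikh-equivalent words of the same length. -/
def AbelianSquare {α : Type*} [DecidableEq α] (w : List α) : Prop :=
  ∃ u v : List α, u ≠ [] ∧ u.length = v.length ∧ ParikhEq u v ∧ w = u ++ v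

/-- The set of distinct abelian square factors of a word `w`. -/
def abelianSquareFactors {α : Type*} [DecidableEq α] (w : List α) : Set (List α) :=
  {u | AbelianSquare u ∧ u <:+: w}

/-- The ternary word `abcbabccacccbabcba` (with `a = 0`, `b = 1`, `c = 2`). -/
def ternaryWord18 : List (Fin 3) :=
  [0, 1, 2, 1, 0, 1, 2, 2, 0, 2, 2, 2, 1, 0, 1, 2, 1, 0]


namespace AbSq

/-- Weight of a letter; the weight of a short word encodes its Parikh vector. -/
def wt (a : Fin 3) : ℕ := if a = 0 then 1 else if a = 1 then 32 else 1024

/-- Weight of a word. -/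
def W : List (Fin 3) → ℕ
  | [] => 0
  | a :: l => wt a + W l

/-- Weights of all suffixes, longest first. -/
def suf : List (Fin 3) → List ℕ
  | [] => [0]
  | a :: l => W (a :: l) :: suf l

/-- Equality test on words. -/
def eqW : List (Fin 3) → List (Fin 3) → Bool
  | [], [] => true
  | a :: l, b :: m => match Nat.beq a.val b.val with
    | true => eqW l m
    | false => false
  | _, _ => false

/-- Look at the abelian squares that are prefixes of `w`, of half-length more than `k`;
stop with `true` if one differs from the recorded one, otherwise go on with `cont`. -/
def go (w : List (Fin 3)) (t0 : ℕ) (cont : Option (List (Fin 3)) → Bool) :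
    List ℕ → ℕ → List ℕ → Option (List (Fin 3)) → Bool
  | _ :: f2 :: fast, k, sk :: slow, s =>
    match Nat.beq (t0 + f2) (2 * sk) with
    | false => go w t0 cont fast (k + 1) slow s
    | true => match s with
      | none => go w t0 cont fast (k + 1) slow (some (w.take (2 * k + 2)))
      | some p => match eqW (w.take (2 * k + 2)) p with
        | true => go w t0 cont fast (k + 1) slow s
        | false => true
  | _, _, _, s => cont s

/-- Exhaustive search over all extensions to the left by `n` letters. -/
def search : ℕ → List (Fin 3) → ℕ → List ℕ → Option (List (Fin 3)) → Bool
  | 0, _, _, _, _ => false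
  | n + 1, w, t, T, s =>
    (go (0 :: w) (1 + t) (search n (0 :: w) (1 + t) (t :: T)) (t :: T) 0 (t :: T) s &&
    go (1 :: w) (32 + t) (search n (1 :: w) (32 + t) (t :: T)) (t :: T) 0 (t :: T) s) &&
    go (2 :: w) (1024 + t) (search n (2 :: w) (1024 + t) (t :: T)) (t :: T) 0 (t :: T) s

/-- Two distinct abelian square factors. -/
def Good (x : List (Fin 3)) : Prop :=
  ∃ p q, p ≠ q ∧ p ∈ abelianSquareFactors x ∧ q ∈ abelianSquareFactors x

theorem W_append (u v : List (Fin 3)) : W (u ++ v) = W u + W v := by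
  induction u with
  | nil => simp [W]
  | cons a l ih => simp [W, ih]; omega

theorem W_count (u : List (Fin 3)) :
    W u = u.count 0 + 32 * u.count 1 + 1024 * u.count 2 ∧
      u.length = u.count 0 + u.count 1 + u.count 2 := by
  induction u with
  | nil => simp [W]
  | cons a l ih =>
    fin_cases a <;> simp [W, wt] <;> omega

theorem parikh_of_W (u v : List (Fin 3)) (hu : u.length < 32) (hv : v.length < 32)
    (h : W u = W v) : ParikhEq u v := by
  have h1 := W_count u
  have h2 := W_count v
  have c0 : u.count 0 = v.count 0 := by omega
  have c1 : u.count 1 = v.count 1 := by omega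
  have c2 : u.count 2 = v.count 2 := by omega
  intro a
  fin_cases a
  · exact c0
  · exact c1
  · exact c2

theorem suf_get (w : List (Fin 3)) (i y : ℕ) (h : (suf w)[i]? = some y) :
    i ≤ w.length ∧ y = W (w.drop i) := by
  induction w generalizing i with
  | nil =>
    cases i with
    | zero => simp [suf] at h; simp [W, h]
    | succ i => simp [suf] at h
  | cons a l ih =>
    cases i with
    | zero => simp [suf] at h; simp [h]
    | succ i =>
      simp [suf] at h
      have := ih i h
      simpa using this

theorem eqW_false (u : List (Fin 3)) (v : List (Fin 3)) (h : eqW u v = false) : u ≠ v := by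
  rintro rfl
  induction u with
  | nil => simp [eqW] at h
  | cons a l ih =>
    have : Nat.beq a.val a.val = true := by simp
    rw [eqW, this] at h
    exact ih h

theorem sq_of_W (w : List (Fin 3)) (hw : w.length < 32) (k : ℕ) (hk : 2 * k + 2 ≤ w.length)
    (h : W w + W (w.drop (2 * k + 2)) = 2 * W (w.drop (k + 1))) :
    AbelianSquare (w.take (2 * k + 2)) := by
  have e1 : W w = W (w.take (k + 1)) + W (w.drop (k + 1)) := by
    rw [← W_append, List.take_append_drop]
  have e2 : W (w.drop (k + 1)) =
      W ((w.drop (k + 1)).take (k + 1)) + W (w.drop (2 * k + 2)) := by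
    have : w.drop (2 * k + 2) = (w.drop (k + 1)).drop (k + 1) := by
      rw [List.drop_drop]; congr 1; omega
    rw [this, ← W_append, List.take_append_drop]
  refine ⟨w.take (k + 1), (w.drop (k + 1)).take (k + 1), ?_, ?_, ?_, ?_⟩
  · intro h0
    have := congrArg List.length h0
    simp at this
    subst this
    simp at hk
  · simp; omega
  · apply parikh_of_W
    · simp; omega
    · simp; omega
    · omega
  · rw [show 2 * k + 2 = (k + 1) + (k + 1) by omega, List.take_add]

theorem mem_of_test (x w : List (Fin 3)) (hw : w.length < 32) (hx : w <:+ x)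
    (f1 f2 : ℕ) (fast : List ℕ) (k sk : ℕ) (slow : List ℕ)
    (hf : f1 :: f2 :: fast = (suf w).drop (2 * k + 1)) (hl : sk :: slow = (suf w).drop (k + 1))
    (hb : Nat.beq (W w + f2) (2 * sk) = true) :
    w.take (2 * k + 2) ∈ abelianSquareFactors x := by
  have g1 : (suf w)[2 * k + 2]? = some f2 := by
    have := congrArg (fun l => l[1]?) hf
    simpa [List.getElem?_drop] using this.symm
  have g2 : (suf w)[k + 1]? = some sk := by
    have := congrArg (fun l => l[0]?) hl
    simpa [List.getElem?_drop] using this.symm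
  obtain ⟨hk, rfl⟩ := suf_get _ _ _ g1
  obtain ⟨-, rfl⟩ := suf_get _ _ _ g2
  exact ⟨sq_of_W w hw k hk (Nat.eq_of_beq_eq_true hb),
    (List.take_prefix _ _).isInfix.trans hx.isInfix⟩

theorem go_sound (x w : List (Fin 3)) (hw : w.length < 32) (hx : w <:+ x)
    (cont : Option (List (Fin 3)) → Bool)
    (hc : ∀ s, (∀ p ∈ s, p ∈ abelianSquareFactors x) → cont s = true → Good x)
    (fast : List ℕ) (k : ℕ) (slow : List ℕ) (s : Option (List (Fin 3)))
    (hf : fast = (suf w).drop (2 * k + 1)) (hl : slow = (suf w).drop (k + 1))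
    (hs : ∀ p ∈ s, p ∈ abelianSquareFactors x)
    (h : go w (W w) cont fast k slow s = true) : Good x := by
  induction fast, k, slow, s using go.induct w (W w) with
  | case1 _ f2 fast k sk slow s hb ih =>
    simp only [go, hb] at h
    refine ih ?_ ?_ hs h
    · have := congrArg (List.drop 2) hf
      simpa [List.drop_drop, Nat.mul_add, Nat.add_assoc] using this
    · have := congrArg (List.drop 1) hl
      simpa [List.drop_drop] using this
  | case2 _ f2 fast k sk slow hb ih =>
    simp only [go, hb] at h
    refine ih ?_ ?_ ?_ h
    · have := congrArg (List.drop 2) hf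
      simpa [List.drop_drop, Nat.mul_add, Nat.add_assoc] using this
    · have := congrArg (List.drop 1) hl
      simpa [List.drop_drop] using this
    · intro p hp
      simp only [Option.mem_def, Option.some.injEq] at hp
      rw [← hp]
      exact mem_of_test x w hw hx _ f2 fast k sk slow hf hl hb
  | case3 _ f2 fast k sk slow hb p he ih =>
    simp only [go, hb, he] at h
    refine ih ?_ ?_ hs h
    · have := congrArg (List.drop 2) hf
      simpa [List.drop_drop, Nat.mul_add, Nat.add_assoc] using this
    · have := congrArg (List.drop 1) hl
      simpa [List.drop_drop] using this
  | case4 _ f2 fast k sk slow hb p he =>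
    exact ⟨_, p, eqW_false _ _ he, mem_of_test x w hw hx _ f2 fast k sk slow hf hl hb,
      hs p rfl⟩
  | case5 fast k slow s hne =>
    rw [go] at h
    · exact hc _ hs h
    · exact hne

theorem search_sound (x : List (Fin 3)) (hx : x.length < 32) (n : ℕ) (w : List (Fin 3))
    (t : ℕ) (T : List ℕ) (s : Option (List (Fin 3)))
    (hT : t :: T = suf w) (ht : t = W w) (hw : w <:+ x) (hn : x.length = w.length + n)
    (hs : ∀ p ∈ s, p ∈ abelianSquareFactors x)
    (h : search n w t T s = true) : Good x := by
  induction n generalizing w t T s with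
  | zero => simp [search] at h
  | succ n ih =>
    have key : ∀ a : Fin 3, a :: w <:+ x →
        go (a :: w) (wt a + t) (search n (a :: w) (wt a + t) (t :: T)) (t :: T) 0 (t :: T) s
          = true → Good x := by
      intro a ha hg
      have e : wt a + t = W (a :: w) := by rw [ht]; rfl
      have hlen := ha.length_le
      rw [e] at hg
      refine go_sound x (a :: w) (by omega) ha _ ?_ _ 0 _ s ?_ ?_ hs hg
      · intro s' hs' h'
        refine ih (a :: w) _ _ s' ?_ rfl ha ?_ hs' h'
        · rw [hT]; rfl
        · simp; omega
      · simp [suf, hT]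
      · simp [suf, hT]
    rw [search, Bool.and_eq_true, Bool.and_eq_true] at h
    obtain ⟨⟨h0, h1⟩, h2⟩ := h
    obtain ⟨v, hv⟩ := hw
    rcases List.eq_nil_or_concat v with rfl | ⟨v', a, rfl⟩
    · subst hv; simp at hn
    · have ha : a :: w <:+ x := ⟨v', by simpa using hv⟩
      fin_cases a
      · exact key 0 ha h0
      · exact key 1 ha h1
      · exact key 2 ha h2

set_option maxRecDepth 100000 in
theorem search_true : search 19 [] 0 [] none = true := by
  decide +kernel

theorem finite_asf (x : List (Fin 3)) : (abelianSquareFactors x).Finite := by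
  refine (List.finite_length_le (Fin 3) x.length).subset ?_
  rintro u ⟨_, hu⟩
  exact hu.length_le

theorem word18_check : ∀ i : Fin 19, ∀ k : Fin 10, 0 < k.val → i.val + 2 * k.val ≤ 18 →
    (∀ a : Fin 3, ((ternaryWord18.drop i.val).take k.val).count a =
      (((ternaryWord18.drop i.val).drop k.val).take k.val).count a) →
    (ternaryWord18.drop i.val).take (k.val + k.val) = [2, 2] := by
  decide +kernel

theorem word18 : abelianSquareFactors ternaryWord18 = {[2, 2]} := by
  ext z
  simp only [abelianSquareFactors, Set.mem_ofPred_eq, Set.mem_singleton_iff]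
  constructor
  · rintro ⟨⟨u, v, hu, hl, hp, rfl⟩, s, t, hst⟩
    have hlen : s.length + (u.length + v.length) + t.length = 18 := by
      have := congrArg List.length hst
      simpa [ternaryWord18, Nat.add_assoc] using this
    have hpos : 0 < u.length := List.length_pos_iff.mpr hu
    have hd : ternaryWord18.drop s.length = u ++ (v ++ t) := by
      rw [← hst]; simp
    have := word18_check ⟨s.length, by omega⟩ ⟨u.length, by omega⟩ hpos
      (by simp only; omega)
    simp only at this
    rw [hd] at this
    have e1 : (u ++ (v ++ t)).take u.length = u := by simp
    have e2 : ((u ++ (v ++ t)).drop u.length).take u.length = v := by simp [hl]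
    have e3 : (u ++ (v ++ t)).take (u.length + u.length) = u ++ v := by
      rw [List.take_length_add_append]; simp [hl]
    rw [e1, e2, e3] at this
    exact this hp
  · rintro rfl
    exact ⟨⟨[2], [2], by simp, rfl, fun _ => rfl, rfl⟩,
      [0, 1, 2, 1, 0, 1], [0, 2, 2, 2, 1, 0, 1, 2, 1, 0], rfl⟩

end AbSq

/-- The longest ternary word with at most one distinct abelian square factor has
length 18: the word `abcbabccacccbabcba` has exactly one distinct abelian square
factor, and every ternary word of length 19 contains at least two distinct
abelian square factors. -/
theorem longest_ternary_word_one_abelian_square :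
    (abelianSquareFactors ternaryWord18).ncard = 1 ∧
    (∀ w : List (Fin 3), w.length = 19 →
      2 ≤ (abelianSquareFactors w).ncard) := by
  refine ⟨by rw [AbSq.word18]; simp, fun w hw => ?_⟩
  obtain ⟨p, q, hpq, hp, hq⟩ : AbSq.Good w :=
    AbSq.search_sound w (by omega) 19 [] 0 [] none rfl rfl (List.nil_suffix) (by simpa using hw)
      (by simp) AbSq.search_true
  exact (Set.one_lt_ncard (AbSq.finite_asf w)).2 ⟨p, hp, q, hq, hpq⟩
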